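/- (Khasminskii-type lemma.) Let w be a (G_t)-Brownian motion with arbitrary initial law, F_t(x, x̂) = (∫₀^t K_{t-s}(x_t − x̂_s) ds · 1_{x_t ≠ x̂_t})², and C₀ the constant from the conditional integral estimate ∫_{t₁}^{t₂} E[F_t(w,x)|G_{t₁}] dt ≤ C₀√T√(t₂−t₁). Then for any κ > 0 there exists a constant C(T, κ), not depending on the initial law of w, such that for all 0 ≤ T₁ ≤ T₂ ≤ T with T₂ − T₁ < 1/(C₀² T κ²) and every continuous path x : [0,T] → ℝ, E[exp(κ ∫_{T₁}^{T₂} F_t(w, x) dt) | G_{T₁}] ≤ C(T, κ) almost surely. -/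

import Mathlib

open MeasureTheory ProbabilityTheory Real

/-- The Keller–Segel kernel `K_t(x) = -x/(√(2π) t^{3/2}) e^{-x²/(2t)}`. -/
noncomputable def K (t x : ℝ) : ℝ :=
  -x / (Real.sqrt (2 * Real.pi) * t ^ ((3 : ℝ) / 2)) * Real.exp (-x ^ 2 / (2 * t))

/-- `F_t(x, x̂) = (∫₀^t K_{t-s}(x_t − x̂_s) ds · 1_{x_t ≠ x̂_t})²`. -/
noncomputable def F (t : ℝ) (x y : ℝ → ℝ) : ℝ :=
  (if x t = y t then 0 else ∫ s in Set.Ioc (0 : ℝ) t, K (t - s) (x t - y s)) ^ 2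

/-- `W` is a `(G_t)`-Brownian motion (with arbitrary initial distribution). -/
def IsBMFiltered {Ω : Type} {m : MeasurableSpace Ω} (P : Measure Ω)
    (G : Filtration ℝ m) (W : ℝ → Ω → ℝ) : Prop :=
  (∀ ω, Continuous fun t => W t ω) ∧
  (∀ t : ℝ, Measurable[G t] (W t)) ∧
  (∀ s t : ℝ, 0 ≤ s → s ≤ t →
    P.map (fun ω => W t ω - W s ω) = gaussianReal 0 (Real.toNNReal (t - s))) ∧
  (∀ s t : ℝ, 0 ≤ s → s ≤ t →
    Indep (MeasurableSpace.comap (fun ω => W t ω - W s ω) Real.measurableSpace) (G s) P)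

lemma aux_meas_phi {α : Type*} [MeasurableSpace α] {f : ℝ → α → ENNReal}
    (hf : Measurable (Function.uncurry f)) (b : ℝ) :
    Measurable (fun p : ℝ × α => ∫⁻ u in Set.Ioc p.1 b, f u p.2) := by
  have : (fun p : ℝ × α => ∫⁻ u in Set.Ioc p.1 b, f u p.2) =
      fun p => ∫⁻ u, ({q : (ℝ × α) × ℝ | q.1.1 < q.2 ∧ q.2 ≤ b}.indicator
        (fun q => f q.2 q.1.2)) (p, u) := by
    funext p
    rw [← lintegral_indicator measurableSet_Ioc]
    rfl
  rw [this]
  refine Measurable.lintegral_prod_right' (f := ({q : (ℝ × α) × ℝ | q.1.1 < q.2 ∧ q.2 ≤ b}.indicator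
        (fun q => f q.2 q.1.2))) ?_
  refine Measurable.indicator ?_ ?_
  · exact hf.comp (measurable_snd.prodMk (measurable_snd.comp measurable_fst))
  · exact (measurableSet_lt (measurable_fst.comp measurable_fst) measurable_snd).inter
      (measurableSet_le measurable_snd measurable_const)

lemma aux_swap {f g : ℝ → ENNReal} (hf : Measurable f) (hg : Measurable g) (s b : ℝ) :
    ∫⁻ u in Set.Ioc s b, g u * ∫⁻ t in Set.Ioc s u, f t =
      ∫⁻ t in Set.Ioc s b, f t * ∫⁻ u in Set.Ioc t b, g u := by
  have hS : MeasurableSet {p : ℝ × ℝ | p.2 < p.1} := measurableSet_lt measurable_snd measurable_fst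
  have e1 : ∫⁻ u in Set.Ioc s b, g u * ∫⁻ t in Set.Ioc s u, f t =
      ∫⁻ u in Set.Ioc s b, ∫⁻ t in Set.Ioc s b,
        ({p : ℝ × ℝ | p.2 < p.1}.indicator fun p => g p.1 * f p.2) (u, t) := by
    refine setLIntegral_congr_fun measurableSet_Ioc fun u hu => ?_
    have : (fun t => ({p : ℝ × ℝ | p.2 < p.1}.indicator fun p => g p.1 * f p.2) (u, t)) =
        (Set.Iio u).indicator fun t => g u * f t := rfl
    simp only [this]
    rw [setLIntegral_indicator measurableSet_Iio, lintegral_const_mul _ hf,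
      setLIntegral_congr Ioo_ae_eq_Ioc.symm]
    congr 3
    ext t
    simp only [Set.mem_Ioo, Set.mem_inter_iff, Set.mem_Iio, Set.mem_Ioc] at hu ⊢
    constructor
    · rintro ⟨h1, h2⟩; exact ⟨h2, h1, by linarith⟩
    · rintro ⟨h1, h2, h3⟩; exact ⟨h2, h1⟩
  have e2 : ∫⁻ t in Set.Ioc s b, f t * ∫⁻ u in Set.Ioc t b, g u =
      ∫⁻ t in Set.Ioc s b, ∫⁻ u in Set.Ioc s b,
        ({p : ℝ × ℝ | p.2 < p.1}.indicator fun p => g p.1 * f p.2) (u, t) := by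
    refine setLIntegral_congr_fun measurableSet_Ioc fun t ht => ?_
    have : (fun u => ({p : ℝ × ℝ | p.2 < p.1}.indicator fun p => g p.1 * f p.2) (u, t)) =
        (Set.Ioi t).indicator fun u => g u * f t := rfl
    simp only [this]
    rw [setLIntegral_indicator measurableSet_Ioi, lintegral_mul_const _ hg, mul_comm]
    congr 3
    ext u
    simp only [Set.mem_inter_iff, Set.mem_Ioi, Set.mem_Ioc] at ht ⊢
    constructor
    · rintro ⟨h1, h2⟩; exact ⟨h1, by linarith, h2⟩
    · rintro ⟨h1, h2, h3⟩; exact ⟨h1, h3⟩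
  rw [e1, e2]
  apply lintegral_lintegral_swap
  refine Measurable.aemeasurable (Measurable.indicator ?_ hS)
  fun_prop

lemma aux_pow {f : ℝ → ENNReal} (hf : Measurable f) (b : ℝ) (n : ℕ) :
    ∀ s, s ≤ b → (∫⁻ t in Set.Ioc s b, f t) ^ (n+1) =
      ((n+1 : ℕ) : ENNReal) * ∫⁻ t in Set.Ioc s b, f t * (∫⁻ u in Set.Ioc t b, f u) ^ n := by
  have hphi : Measurable fun t => ∫⁻ u in Set.Ioc t b, f u := by
    have h := aux_meas_phi (α := Unit) (f := fun t _ => f t) (hf.comp measurable_fst) b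
    exact h.comp (measurable_id.prodMk measurable_const : Measurable fun t : ℝ => (t, ()))
  induction n with
  | zero => intro s _; simp
  | succ n ih =>
    intro s hs
    have hg : Measurable fun u => f u * (∫⁻ v in Set.Ioc u b, f v) ^ n := hf.mul (hphi.pow_const n)
    have hg2 : Measurable fun u => f u * (∫⁻ v in Set.Ioc u b, f v) ^ (n+1) :=
      hf.mul (hphi.pow_const (n+1))
    have hsplit : (∫⁻ u in Set.Ioc s b, f u * (∫⁻ v in Set.Ioc u b, f v) ^ n) * ∫⁻ t in Set.Ioc s b, f t
       = ∫⁻ u in Set.Ioc s b, (f u * (∫⁻ v in Set.Ioc u b, f v) ^ n * (∫⁻ t in Set.Ioc s u, f t)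
          + f u * (∫⁻ v in Set.Ioc u b, f v) ^ (n+1)) := by
      rw [← lintegral_mul_const _ hg]
      refine setLIntegral_congr_fun measurableSet_Ioc fun u hu => ?_
      rw [← Set.Ioc_union_Ioc_eq_Ioc hu.1.le hu.2, lintegral_union measurableSet_Ioc
        (Set.Ioc_disjoint_Ioc_of_le le_rfl)]
      ring
    rw [pow_succ, ih s hs, mul_assoc, hsplit, lintegral_add_right _ hg2,
      aux_swap hf hg, mul_add, ← lintegral_const_mul]
    · have : ∫⁻ t in Set.Ioc s b, ((n+1 : ℕ) : ENNReal) *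
          (f t * ∫⁻ u in Set.Ioc t b, f u * (∫⁻ v in Set.Ioc u b, f v) ^ n) =
          ∫⁻ t in Set.Ioc s b, f t * (∫⁻ u in Set.Ioc t b, f u) ^ (n+1) := by
        refine setLIntegral_congr_fun measurableSet_Ioc fun t ht => ?_
        rw [ih t ht.2]; ring
      rw [this]
      push_cast; ring
    · have h := aux_meas_phi (α := Unit) (f := fun t _ => f t * (∫⁻ v in Set.Ioc t b, f v) ^ n)
        (hg.comp measurable_fst) b
      exact hf.mul (h.comp (measurable_id.prodMk measurable_const : Measurable fun t : ℝ => (t, ())))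

lemma aux_gauss (u : ℝ) (hu : 0 < u) :
    ∫⁻ y, ‖K u y‖ₑ ^ 2 ≤ ENNReal.ofReal (u ^ (-(3:ℝ)/2)) := by
  have hb : 0 < 1 / (2 * u) := by positivity
  have key : ∀ y, ‖K u y‖ₑ ^ 2 ≤
      ENNReal.ofReal (1 / (Real.pi * u ^ 2) * Real.exp (-(1 / (2 * u)) * y ^ 2)) := by
    intro y
    rw [← ofReal_norm, ← ENNReal.ofReal_pow (norm_nonneg _)]
    apply ENNReal.ofReal_le_ofReal
    rw [Real.norm_eq_abs, sq_abs]
    unfold K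
    have h1 : (u ^ ((3:ℝ)/2)) ^ 2 = u ^ 3 := by
      rw [← Real.rpow_natCast, ← Real.rpow_mul hu.le]; norm_num
    have h2 : Real.sqrt (2 * Real.pi) ^ 2 = 2 * Real.pi := Real.sq_sqrt (by positivity)
    have h3 : Real.exp (-y ^ 2 / (2 * u)) ^ 2
        = Real.exp (-(1 / (2 * u)) * y ^ 2) * Real.exp (-y ^ 2 / (2 * u)) := by
      rw [sq]; congr 2; ring
    have h4 : y ^ 2 / (2 * u) * Real.exp (-y ^ 2 / (2 * u)) ≤ 1 := by
      have := Real.add_one_le_exp (y ^ 2 / (2 * u))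
      have h5 : Real.exp (-y ^ 2 / (2 * u)) = (Real.exp (y ^ 2 / (2 * u)))⁻¹ := by
        rw [← Real.exp_neg]; congr 1; ring
      rw [h5, ← div_eq_mul_inv, div_le_one (Real.exp_pos _)]
      linarith
    rw [mul_pow, div_pow, mul_pow, h1, h2, h3]
    have : (-y) ^ 2 / (2 * Real.pi * u ^ 3) * (Real.exp (-(1 / (2 * u)) * y ^ 2) * Real.exp (-y ^ 2 / (2 * u)))
      = 1 / (Real.pi * u ^ 2) * Real.exp (-(1 / (2 * u)) * y ^ 2) * (y ^ 2 / (2 * u) * Real.exp (-y ^ 2 / (2 * u))) := by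
      field_simp
    rw [this]
    exact mul_le_of_le_one_right (by positivity) h4
  refine (lintegral_mono key).trans ?_
  rw [← ofReal_integral_eq_lintegral_ofReal ((integrable_exp_neg_mul_sq hb).const_mul _)
    (Filter.Eventually.of_forall fun y => by positivity)]
  apply ENNReal.ofReal_le_ofReal
  rw [integral_const_mul, integral_gaussian]
  have e1 : u ^ (-(3:ℝ)/2) = Real.sqrt u / u ^ 2 := by
    rw [Real.sqrt_eq_rpow, ← Real.rpow_natCast u 2, ← Real.rpow_sub hu]; norm_num
  have e2 : Real.pi / (1 / (2 * u)) = 2 * Real.pi * u := by field_simp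
  rw [e1, e2, Real.sqrt_mul (by positivity)]
  have e3 : Real.sqrt (2 * Real.pi) ≤ Real.pi := by
    apply Real.sqrt_le_iff.2 ⟨Real.pi_pos.le, ?_⟩
    nlinarith [Real.pi_gt_three]
  rw [show 1 / (Real.pi * u ^ 2) * (Real.sqrt (2 * Real.pi) * Real.sqrt u) =
    (Real.sqrt (2 * Real.pi) / Real.pi) * (Real.sqrt u / u ^ 2) by field_simp]
  exact mul_le_of_le_one_left (by positivity) ((div_le_one Real.pi_pos).2 e3)

lemma aux_density (v : ℝ) (hv : 0 < v) (ψ : ℝ → ENNReal) (hψ : Measurable ψ) (w : ℝ) :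
    ∫⁻ d, ψ (w + d) ∂(gaussianReal 0 (Real.toNNReal v)) ≤
      ENNReal.ofReal (v ^ (-(1:ℝ)/2)) * ∫⁻ y, ψ y := by
  have hv' : Real.toNNReal v ≠ 0 := by simpa using hv
  have hm : Measurable fun d => ψ (w + d) := hψ.comp (measurable_const_add w)
  rw [gaussianReal_of_var_ne_zero _ hv',
    lintegral_withDensity_eq_lintegral_mul _ (measurable_gaussianPDF _ _) hm]
  rw [← lintegral_add_left_eq_self ψ w, ← lintegral_const_mul _ hm]
  refine lintegral_mono fun d => ?_
  simp only [Pi.mul_apply]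
  gcongr
  unfold gaussianPDF gaussianPDFReal
  apply ENNReal.ofReal_le_ofReal
  rw [Real.coe_toNNReal v hv.le]
  have h1 : Real.exp (-(d - 0) ^ 2 / (2 * v)) ≤ 1 := by
    rw [Real.exp_le_one_iff]
    apply div_nonpos_of_nonpos_of_nonneg <;> nlinarith [sq_nonneg (d-0)]
  have h2 : (Real.sqrt (2 * Real.pi * v))⁻¹ ≤ v ^ (-(1:ℝ)/2) := by
    rw [neg_div, Real.rpow_neg hv.le, ← Real.sqrt_eq_rpow]
    gcongr
    nlinarith [Real.pi_gt_three]
  exact (mul_le_of_le_one_right (by positivity) h1).trans h2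

lemma aux_indep {Ω : Type} {m : MeasurableSpace Ω} {P : Measure Ω} [IsProbabilityMeasure P]
    {G : Filtration ℝ m} {W : ℝ → Ω → ℝ} (hW : IsBMFiltered P G W) (s t : ℝ) (hs : 0 ≤ s)
    (hst : s < t) (Z : Ω → ENNReal) (hZ : Measurable[G s] Z)
    (ψ : ℝ → ENNReal) (hψ : Measurable ψ) :
    ∫⁻ ω, Z ω * ψ (W t ω) ∂P ≤
      ENNReal.ofReal ((t - s) ^ (-(1:ℝ)/2)) * (∫⁻ y, ψ y) * ∫⁻ ω, Z ω ∂P := by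
  obtain ⟨-, hm, hl, hi⟩ := hW
  have hZW : Measurable[G s] (fun ω => (Z ω, W s ω)) := hZ.prodMk (hm s)
  have hZW' : Measurable (fun ω => (Z ω, W s ω)) := hZW.mono (G.le s) le_rfl
  have hZ' : Measurable Z := hZ.mono (G.le s) le_rfl
  have hD : Measurable (fun ω => W t ω - W s ω) :=
    ((hm t).mono (G.le t) le_rfl).sub ((hm s).mono (G.le s) le_rfl)
  have hind : IndepFun (fun ω => (Z ω, W s ω)) (fun ω => W t ω - W s ω) P := by
    rw [IndepFun_iff_Indep]
    exact (indep_of_indep_of_le_right (hi s t hs hst.le) (hZW.comap_le)).symm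
  have hprod := (indepFun_iff_map_prod_eq_prod_map_map hZW'.aemeasurable hD.aemeasurable).1 hind
  have hg : Measurable (fun p : (ENNReal × ℝ) × ℝ => p.1.1 * ψ (p.1.2 + p.2)) := by fun_prop
  have e1 : ∫⁻ ω, Z ω * ψ (W t ω) ∂P = ∫⁻ p, p.1.1 * ψ (p.1.2 + p.2)
      ∂(P.map fun ω => ((Z ω, W s ω), W t ω - W s ω)) := by
    rw [lintegral_map hg (hZW'.prodMk hD)]
    simp
  have : IsProbabilityMeasure (P.map (fun ω => W t ω - W s ω)) :=
    Measure.isProbabilityMeasure_map hD.aemeasurable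
  rw [e1, hprod, lintegral_prod _ hg.aemeasurable, lintegral_map hg.lintegral_prod_right' hZW',
    hl s t hs hst.le, ← lintegral_const_mul _ hZ']
  refine lintegral_mono fun ω => ?_
  have hm2 : Measurable fun d => ψ (W s ω + d) := hψ.comp (measurable_const_add _)
  change ∫⁻ d, Z ω * ψ (W s ω + d) ∂_ ≤ _
  rw [lintegral_const_mul _ hm2, mul_comm]
  gcongr
  exact aux_density (t - s) (by linarith) ψ hψ _

lemma aux_sing (t : ℝ) (ht : 0 < t) :
    ∫⁻ r in Set.Ioo 0 t, ENNReal.ofReal ((t - r) ^ (-(3:ℝ)/4)) ≤ ENNReal.ofReal (4 * t ^ ((1:ℝ)/4)) := by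
  have hi : IntervalIntegrable (fun r : ℝ => r ^ (-(3:ℝ)/4)) volume 0 t :=
    intervalIntegral.intervalIntegrable_rpow' (by norm_num)
  have hi2 : IntervalIntegrable (fun r : ℝ => (t - r) ^ (-(3:ℝ)/4)) volume 0 t := by
    simpa using (hi.comp_sub_left t).symm
  have hi3 : IntegrableOn (fun r : ℝ => (t - r) ^ (-(3:ℝ)/4)) (Set.Ioo 0 t) :=
    ((intervalIntegrable_iff_integrableOn_Ioo_of_le ht.le).1 hi2)
  rw [← ofReal_integral_eq_lintegral_ofReal hi3]
  · apply ENNReal.ofReal_le_ofReal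
    rw [← integral_Ioc_eq_integral_Ioo, ← intervalIntegral.integral_of_le ht.le,
      intervalIntegral.integral_comp_sub_left (fun r : ℝ => r ^ (-(3:ℝ)/4)), 
      integral_rpow (by left; norm_num)]
    norm_num
    linarith
  · filter_upwards [ae_restrict_mem measurableSet_Ioo] with r hr
    exact Real.rpow_nonneg (by linarith [hr.2]) _

lemma aux_exp (l s b a : ℝ) (hl : 0 < l) (ha : 0 ≤ a) :
    ∫⁻ t in Set.Ioc s b, ENNReal.ofReal (Real.exp (l * (b - t)) * (a * (t - s) ^ (-(1:ℝ)/2))) ≤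
      ENNReal.ofReal (Real.exp (l * (b - s)) * (a * Real.sqrt (Real.pi / l))) := by
  have hint : IntegrableOn (fun r : ℝ => r ^ ((1:ℝ)/2 - 1) * Real.exp (-(l * r))) (Set.Ioi 0) := by
    simpa using integrableOn_rpow_mul_exp_neg_mul_rpow (s := (1:ℝ)/2 - 1) (p := 1) (by norm_num) one_pos hl
  have hval := Real.integral_rpow_mul_exp_neg_mul_Ioi (a := 1/2) (r := l) (by norm_num) hl
  have hm : Measurable (fun r : ℝ => ENNReal.ofReal (r ^ ((1:ℝ)/2 - 1) * Real.exp (-(l * r)))) := by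
    fun_prop
  calc _ ≤ ∫⁻ t in Set.Ioi s, ENNReal.ofReal (Real.exp (l * (b - t)) * (a * (t - s) ^ (-(1:ℝ)/2))) :=
        lintegral_mono_set Set.Ioc_subset_Ioi_self
    _ = ∫⁻ t in Set.Ioi s, ENNReal.ofReal (Real.exp (l * (b - s)) * a) * 
          ENNReal.ofReal ((t - s) ^ ((1:ℝ)/2 - 1) * Real.exp (-(l * (t - s)))) := by
        congr 1; funext t
        rw [← ENNReal.ofReal_mul (by positivity)]
        congr 1
        rw [show l * (b - t) = l * (b - s) + -(l * (t - s)) by ring, Real.exp_add]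
        norm_num; ring
    _ = ENNReal.ofReal (Real.exp (l * (b - s)) * a) * ∫⁻ t in Set.Ioi 0,
          ENNReal.ofReal (t ^ ((1:ℝ)/2 - 1) * Real.exp (-(l * t))) := by
        rw [lintegral_const_mul _ (by fun_prop)]
        congr 1
        rw [← lintegral_indicator measurableSet_Ioi, ← lintegral_indicator measurableSet_Ioi,
          ← lintegral_sub_right_eq_self
            ((Set.Ioi (0:ℝ)).indicator fun t => ENNReal.ofReal (t ^ ((1:ℝ)/2 - 1) * Real.exp (-(l * t)))) s]
        congr 1; funext t
        simp [Set.indicator]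
    _ ≤ _ := by
        rw [← ofReal_integral_eq_lintegral_ofReal hint, hval, ← ENNReal.ofReal_mul (by positivity)]
        · apply ENNReal.ofReal_le_ofReal
          rw [Real.Gamma_one_half_eq, ← Real.sqrt_eq_rpow, Real.sqrt_div' _ hl.le, 
            Real.sqrt_div' _ hl.le]
          simp only [Real.sqrt_one]
          apply le_of_eq; ring
        · filter_upwards [ae_restrict_mem measurableSet_Ioi] with r hr
          have : 0 < r := hr
          positivity

lemma aux_measK : Measurable (fun p : ℝ × ℝ => K p.1 p.2) := by
  unfold K
  fun_prop

lemma aux_measH (x : ℝ → ℝ) (hx : Continuous x) :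
    Measurable (fun p : ℝ × ℝ => F p.1 (fun _ => p.2) x) := by
  unfold F
  refine Measurable.pow_const (Measurable.ite ?_ measurable_const ?_) 2
  · exact measurableSet_eq_fun measurable_snd (hx.measurable.comp measurable_fst)
  · have : (fun p : ℝ × ℝ => ∫ s in Set.Ioc 0 p.1, K (p.1 - s) (p.2 - x s)) =
      fun p => ∫ s, ({q : (ℝ × ℝ) × ℝ | 0 < q.2 ∧ q.2 ≤ q.1.1}.indicator
        (fun q => K (q.1.1 - q.2) (q.1.2 - x q.2))) (p, s) := by
      funext p
      rw [← integral_indicator measurableSet_Ioc]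
      rfl
    rw [this]
    refine (StronglyMeasurable.integral_prod_right' (f := ({q : (ℝ × ℝ) × ℝ | 0 < q.2 ∧ q.2 ≤ q.1.1}.indicator
        (fun q => K (q.1.1 - q.2) (q.1.2 - x q.2)))) ?_).measurable
    refine (Measurable.indicator ?_ ?_).stronglyMeasurable
    · have := hx.measurable
      exact aux_measK.comp (by fun_prop : Measurable fun q : (ℝ × ℝ) × ℝ => (q.1.1 - q.2, q.1.2 - x q.2))
    · exact (measurableSet_lt measurable_const measurable_snd).inter
        (measurableSet_le measurable_snd (measurable_fst.comp measurable_fst))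

lemma aux_cs (t y : ℝ) (ht : 0 < t) (x : ℝ → ℝ) (hx : Continuous x) :
    ENNReal.ofReal (F t (fun _ => y) x) ≤ ENNReal.ofReal (4 * t ^ ((1:ℝ)/4)) *
      ∫⁻ r in Set.Ioo 0 t, ENNReal.ofReal ((t - r) ^ ((3:ℝ)/4)) * ‖K (t - r) (y - x r)‖ₑ ^ 2 := by
  have hk : Measurable fun r => K (t - r) (y - x r) := by
    have := hx.measurable
    exact aux_measK.comp (by fun_prop : Measurable fun r : ℝ => (t - r, y - x r))
  have h1 : ENNReal.ofReal (F t (fun _ => y) x) ≤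
      (∫⁻ r in Set.Ioo 0 t, ‖K (t - r) (y - x r)‖ₑ) ^ 2 := by
    unfold F
    split_ifs
    · simp
    · rw [← sq_abs, ENNReal.ofReal_pow (abs_nonneg _), ← Real.norm_eq_abs, ofReal_norm,
        setLIntegral_congr Ioo_ae_eq_Ioc]
      gcongr
      exact enorm_integral_le_lintegral_enorm _
  refine h1.trans ?_
  have h2 : ∫⁻ r in Set.Ioo 0 t, ‖K (t - r) (y - x r)‖ₑ =
      ∫⁻ r in Set.Ioo 0 t, ((fun r => ENNReal.ofReal ((t - r) ^ (-(3:ℝ)/8))) *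
        fun r => ENNReal.ofReal ((t - r) ^ ((3:ℝ)/8)) * ‖K (t - r) (y - x r)‖ₑ) r := by
    refine setLIntegral_congr_fun measurableSet_Ioo fun r hr => ?_
    have hr' : 0 < t - r := by linarith [hr.2]
    simp only [Pi.mul_apply]
    rw [← mul_assoc, ← ENNReal.ofReal_mul (by positivity), ← Real.rpow_add hr']
    norm_num
  rw [h2]
  have h3 := ENNReal.lintegral_mul_le_Lp_mul_Lq (volume.restrict (Set.Ioo 0 t))
    Real.HolderConjugate.two_two
    (f := fun r => ENNReal.ofReal ((t - r) ^ (-(3:ℝ)/8)))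
    (g := fun r => ENNReal.ofReal ((t - r) ^ ((3:ℝ)/8)) * ‖K (t - r) (y - x r)‖ₑ)
    (by fun_prop) (by fun_prop)
  refine (pow_le_pow_left' h3 2).trans ?_
  rw [mul_pow]
  have hsq : ∀ z : ENNReal, (z ^ ((1:ℝ)/2)) ^ 2 = z := by
    intro z
    rw [← ENNReal.rpow_natCast, ← ENNReal.rpow_mul]; norm_num
  rw [hsq, hsq]
  gcongr ?_ * ?_
  · refine le_trans (le_of_eq ?_) (aux_sing t ht)
    refine setLIntegral_congr_fun measurableSet_Ioo fun r hr => ?_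
    have hr' : 0 < t - r := by linarith [hr.2]
    rw [ENNReal.ofReal_rpow_of_pos (by positivity), ← Real.rpow_mul hr'.le]
    norm_num
  · refine le_of_eq ?_
    refine setLIntegral_congr_fun measurableSet_Ioo fun r hr => ?_
    have hr' : 0 < t - r := by linarith [hr.2]
    rw [ENNReal.mul_rpow_of_nonneg _ _ (by norm_num),
      ENNReal.ofReal_rpow_of_pos (by positivity), ← Real.rpow_mul hr'.le]
    norm_num

lemma aux_core {Ω : Type} {m : MeasurableSpace Ω} {P : Measure Ω} [IsProbabilityMeasure P]
    {G : Filtration ℝ m} {W : ℝ → Ω → ℝ} (hW : IsBMFiltered P G W) (x : ℝ → ℝ) (hx : Continuous x)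
    (T s t : ℝ) (hs : 0 ≤ s)
    (hst : s < t) (htT : t ≤ T) (Z : Ω → ENNReal) (hZ : Measurable[G s] Z) :
    ∫⁻ ω, Z ω * ENNReal.ofReal (F t (fun u => W u ω) x) ∂P ≤
      ENNReal.ofReal (16 * Real.sqrt T * (t - s) ^ (-(1:ℝ)/2)) * ∫⁻ ω, Z ω ∂P := by
  have ht : 0 < t := by linarith
  have hWt : Measurable (W t) := (hW.2.1 t).mono (G.le t) le_rfl
  have hZ' : Measurable Z := hZ.mono (G.le s) le_rfl
  have hj : Measurable fun p : Ω × ℝ => K (t - p.2) (W t p.1 - x p.2) := by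
    have := hx.measurable
    exact aux_measK.comp (by fun_prop : Measurable fun p : Ω × ℝ => (t - p.2, W t p.1 - x p.2))
  have hj2 : ∀ ω, Measurable fun r => K (t - r) (W t ω - x r) := fun ω =>
    hj.comp (measurable_const.prodMk measurable_id)
  have hj3 : ∀ r, Measurable fun ω => K (t - r) (W t ω - x r) := fun r =>
    hj.comp (measurable_id.prodMk measurable_const)
  set c := ENNReal.ofReal (4 * t ^ ((1:ℝ)/4)) with hc
  calc ∫⁻ ω, Z ω * ENNReal.ofReal (F t (fun u => W u ω) x) ∂P
      ≤ ∫⁻ ω, c * (∫⁻ r in Set.Ioo 0 t, Z ω * (ENNReal.ofReal ((t - r) ^ ((3:ℝ)/4)) *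
          ‖K (t - r) (W t ω - x r)‖ₑ ^ 2)) ∂P := by
        refine lintegral_mono fun ω => ?_
        have := hj2 ω
        rw [lintegral_const_mul _ (by fun_prop), mul_left_comm]
        gcongr
        exact aux_cs t (W t ω) ht x hx
    _ = c * ∫⁻ r in Set.Ioo 0 t, ∫⁻ ω, Z ω * (ENNReal.ofReal ((t - r) ^ ((3:ℝ)/4)) *
          ‖K (t - r) (W t ω - x r)‖ₑ ^ 2) ∂P := by
        have hmm : Measurable fun p : Ω × ℝ => Z p.1 * (ENNReal.ofReal ((t - p.2) ^ ((3:ℝ)/4)) *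
          ‖K (t - p.2) (W t p.1 - x p.2)‖ₑ ^ 2) := by fun_prop
        rw [lintegral_const_mul _ hmm.lintegral_prod_right', lintegral_lintegral_swap hmm.aemeasurable]
    _ ≤ c * ∫⁻ r in Set.Ioo 0 t, (ENNReal.ofReal ((t - s) ^ (-(1:ℝ)/2)) * ∫⁻ ω, Z ω ∂P) *
          ENNReal.ofReal ((t - r) ^ (-(3:ℝ)/4)) := by
        refine mul_le_mul' le_rfl ?_
        refine setLIntegral_mono' measurableSet_Ioo fun r hr => ?_
        have hr' : 0 < t - r := by linarith [hr.2]
        have hK : Measurable fun y => ‖K (t - r) (y - x r)‖ₑ ^ 2 := by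
          have := aux_measK.comp (by fun_prop : Measurable fun y : ℝ => (t - r, y - x r))
          exact (this.enorm).pow_const 2
        have h1 := aux_indep hW s t hs hst Z hZ _ hK
        have h2 : ∫⁻ y, ‖K (t - r) (y - x r)‖ₑ ^ 2 ≤ ENNReal.ofReal ((t - r) ^ (-(3:ℝ)/2)) := by
          rw [lintegral_sub_right_eq_self (fun y => ‖K (t - r) y‖ₑ ^ 2) (x r)]
          exact aux_gauss _ hr'
        have h3 : ∫⁻ ω, Z ω * (ENNReal.ofReal ((t - r) ^ ((3:ℝ)/4)) *
            ‖K (t - r) (W t ω - x r)‖ₑ ^ 2) ∂P = ENNReal.ofReal ((t - r) ^ ((3:ℝ)/4)) *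
            ∫⁻ ω, Z ω * ‖K (t - r) (W t ω - x r)‖ₑ ^ 2 ∂P := by
          have := hj3 r
          rw [← lintegral_const_mul _ (by fun_prop)]
          congr 1; funext ω; ring
        have h4 : ENNReal.ofReal ((t - r) ^ (-(3:ℝ)/4)) = ENNReal.ofReal ((t - r) ^ ((3:ℝ)/4)) *
            ENNReal.ofReal ((t - r) ^ (-(3:ℝ)/2)) := by
          rw [← ENNReal.ofReal_mul (by positivity), ← Real.rpow_add hr']; norm_num
        rw [h3, h4, mul_left_comm]
        refine mul_le_mul' le_rfl ?_
        refine h1.trans ?_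
        rw [mul_assoc, mul_assoc, mul_comm (∫⁻ ω, Z ω ∂P)]
        gcongr
    _ ≤ c * ((ENNReal.ofReal ((t - s) ^ (-(1:ℝ)/2)) * ∫⁻ ω, Z ω ∂P) * c) := by
        rw [lintegral_const_mul _ (by fun_prop)]
        gcongr
        exact aux_sing t ht
    _ = (c * c * ENNReal.ofReal ((t - s) ^ (-(1:ℝ)/2))) * ∫⁻ ω, Z ω ∂P := by ring
    _ ≤ _ := by
        gcongr ?_ * _
        have hts : 0 < t - s := by linarith
        rw [hc, ← ENNReal.ofReal_mul (by positivity), ← ENNReal.ofReal_mul (by positivity)]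
        apply ENNReal.ofReal_le_ofReal
        gcongr ?_ * _
        have : t ^ ((1:ℝ)/4) * t ^ ((1:ℝ)/4) = Real.sqrt t := by
          rw [← Real.rpow_add ht, Real.sqrt_eq_rpow]; norm_num
        have := Real.sqrt_le_sqrt htT
        nlinarith

lemma aux_mom {Ω : Type} {m : MeasurableSpace Ω} {P : Measure Ω} [IsProbabilityMeasure P]
    {G : Filtration ℝ m} {f : ℝ → Ω → ENNReal} (hf : Measurable (Function.uncurry f))
    (hG : ∀ t, Measurable[G t] (f t)) (a l b : ℝ) (ha : 0 ≤ a) (hl : 0 < l)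
    (core : ∀ s t, 0 ≤ s → s < t → t ≤ b → ∀ Z : Ω → ENNReal, Measurable[G s] Z →
      ∫⁻ ω, Z ω * f t ω ∂P ≤ ENNReal.ofReal (a * (t - s) ^ (-(1:ℝ)/2)) * ∫⁻ ω, Z ω ∂P) (n : ℕ) :
    ∀ s, 0 ≤ s → s ≤ b → ∀ Z : Ω → ENNReal, Measurable[G s] Z →
      ∫⁻ ω, Z ω * (∫⁻ t in Set.Ioc s b, f t ω) ^ n ∂P ≤
        (n.factorial : ENNReal) * ENNReal.ofReal (a * Real.sqrt (Real.pi / l)) ^ n *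
          ENNReal.ofReal (Real.exp (l * (b - s))) * ∫⁻ ω, Z ω ∂P := by
  have hphi := aux_meas_phi hf b
  have hft : ∀ ω, Measurable fun t => f t ω := fun ω => hf.comp (measurable_id.prodMk measurable_const)
  induction n with
  | zero =>
    intro s hs hsb Z hZ
    simp only [pow_zero, mul_one, Nat.factorial_zero, Nat.cast_one, one_mul]
    apply le_mul_of_one_le_left'
    rw [ENNReal.one_le_ofReal]
    apply Real.one_le_exp
    have : 0 ≤ b - s := by linarith
    positivity
  | succ n ih =>
    intro s hs hsb Z hZ
    have hZ' : Measurable Z := hZ.mono (G.le s) le_rfl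
    have hmm : Measurable fun p : Ω × ℝ => Z p.1 * f p.2 p.1 * (∫⁻ u in Set.Ioc p.2 b, f u p.1) ^ n := by
      have h1 : Measurable fun p : Ω × ℝ => f p.2 p.1 := hf.comp measurable_swap
      have h2 : Measurable fun p : Ω × ℝ => ∫⁻ u in Set.Ioc p.2 b, f u p.1 := hphi.comp measurable_swap
      exact ((hZ'.comp measurable_fst).mul h1).mul (h2.pow_const n)
    set q := ENNReal.ofReal (a * Real.sqrt (Real.pi / l))
    calc ∫⁻ ω, Z ω * (∫⁻ t in Set.Ioc s b, f t ω) ^ (n+1) ∂P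
        = ∫⁻ ω, ((n+1 : ℕ) : ENNReal) * (∫⁻ t in Set.Ioc s b,
            Z ω * f t ω * (∫⁻ u in Set.Ioc t b, f u ω) ^ n) ∂P := by
          congr 1; funext ω
          have hp : Measurable fun t => ∫⁻ u in Set.Ioc t b, f u ω :=
            hphi.comp (measurable_id.prodMk measurable_const)
          have hp2 : Measurable fun t => f t ω * (∫⁻ u in Set.Ioc t b, f u ω) ^ n :=
            (hft ω).mul (hp.pow_const n)
          rw [aux_pow (hft ω) b n s hsb, mul_left_comm, ← lintegral_const_mul _ hp2]
          simp only [mul_assoc]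
      _ = ((n+1 : ℕ) : ENNReal) * ∫⁻ t in Set.Ioc s b, ∫⁻ ω, 
            Z ω * f t ω * (∫⁻ u in Set.Ioc t b, f u ω) ^ n ∂P := by
          rw [lintegral_const_mul _ hmm.lintegral_prod_right', lintegral_lintegral_swap hmm.aemeasurable]
      _ ≤ ((n+1 : ℕ) : ENNReal) * ∫⁻ t in Set.Ioc s b, (n.factorial * q ^ n * ∫⁻ ω, Z ω ∂P) *
            ENNReal.ofReal (Real.exp (l * (b - t)) * (a * (t - s) ^ (-(1:ℝ)/2))) := by
          refine mul_le_mul' le_rfl ?_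
          refine setLIntegral_mono' measurableSet_Ioc fun t ht => ?_
          have hm1 : Measurable[G t] fun ω => Z ω * f t ω :=
            (hZ.mono (G.mono ht.1.le) le_rfl).mul (hG t)
          refine (ih t (hs.trans ht.1.le) ht.2 _ hm1).trans ?_
          rw [ENNReal.ofReal_mul (by positivity)]
          calc _ ≤ n.factorial * q ^ n * ENNReal.ofReal (Real.exp (l * (b - t))) *
                (ENNReal.ofReal (a * (t - s) ^ (-(1:ℝ)/2)) * ∫⁻ ω, Z ω ∂P) := by
                gcongr
                exact core s t hs ht.1 ht.2 Z hZ
            _ = _ := by ring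
      _ ≤ ((n+1 : ℕ) : ENNReal) * ((n.factorial * q ^ n * ∫⁻ ω, Z ω ∂P) *
            ENNReal.ofReal (Real.exp (l * (b - s)) * (a * Real.sqrt (Real.pi / l)))) := by
          rw [lintegral_const_mul _ (by fun_prop)]
          gcongr
          exact aux_exp l s b a hl ha
      _ = _ := by
          rw [ENNReal.ofReal_mul (by positivity), Nat.factorial_succ]
          push_cast; ring

lemma aux_expmom {Ω : Type} {m : MeasurableSpace Ω} {P : Measure Ω} [IsProbabilityMeasure P]
    {G : Filtration ℝ m} {f : ℝ → Ω → ℝ} (hf : Measurable (Function.uncurry f))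
    (hf0 : ∀ t ω, 0 ≤ f t ω)
    (hG : ∀ t, Measurable[G t] (f t)) (a l b κ : ℝ) (ha : 0 ≤ a) (hl : 0 < l) (hκ : 0 < κ)
    (hq : κ * (a * Real.sqrt (Real.pi / l)) = 1 / 2)
    (core : ∀ s t, 0 ≤ s → s < t → t ≤ b → ∀ Z : Ω → ENNReal, Measurable[G s] Z →
      ∫⁻ ω, Z ω * ENNReal.ofReal (f t ω) ∂P ≤
        ENNReal.ofReal (a * (t - s) ^ (-(1:ℝ)/2)) * ∫⁻ ω, Z ω ∂P)
    (s : ℝ) (hs : 0 ≤ s) (hsb : s ≤ b) (Z : Ω → ENNReal) (hZ : Measurable[G s] Z) :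
    ∫⁻ ω, Z ω * ENNReal.ofReal (Real.exp (κ * ∫ t in Set.Ioc s b, f t ω)) ∂P ≤
      ENNReal.ofReal (2 * Real.exp (l * (b - s))) * ∫⁻ ω, Z ω ∂P := by
  have hf' : Measurable (Function.uncurry fun t ω => ENNReal.ofReal (f t ω)) := hf.ennreal_ofReal
  have hZ' : Measurable Z := hZ.mono (G.le s) le_rfl
  have hphi : Measurable fun ω => ∫⁻ t in Set.Ioc s b, ENNReal.ofReal (f t ω) :=
    (aux_meas_phi hf' b).comp (measurable_const.prodMk measurable_id)
  have mom := fun n => aux_mom (P := P) hf' (fun t => (hG t).ennreal_ofReal) a l b ha hl core n s hs hsb Z hZ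
  have hpt : ∀ ω, ENNReal.ofReal (Real.exp (κ * ∫ t in Set.Ioc s b, f t ω)) ≤
      ∑' n : ℕ, ENNReal.ofReal (κ ^ n / n.factorial) *
        (∫⁻ t in Set.Ioc s b, ENNReal.ofReal (f t ω)) ^ n := by
    intro ω
    set y := ∫ t in Set.Ioc s b, f t ω with hy
    have hy0 : 0 ≤ y := integral_nonneg fun t => hf0 t ω
    have hyl : ENNReal.ofReal y ≤ ∫⁻ t in Set.Ioc s b, ENNReal.ofReal (f t ω) := by
      rw [hy, integral_eq_lintegral_of_nonneg_ae (Filter.Eventually.of_forall fun t => hf0 t ω)]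
      · exact ENNReal.ofReal_toReal_le
      · exact (hf.comp (measurable_id.prodMk measurable_const)).aestronglyMeasurable
    rw [Real.exp_eq_exp_ℝ, NormedSpace.exp_eq_tsum_div]
    simp only
    rw [ENNReal.ofReal_tsum_of_nonneg (fun n => by positivity) (Real.summable_pow_div_factorial _)]
    refine ENNReal.tsum_le_tsum fun n => ?_
    rw [mul_pow, mul_div_right_comm, ENNReal.ofReal_mul (by positivity), ENNReal.ofReal_pow hy0]
    gcongr
  calc _ ≤ ∫⁻ ω, ∑' n : ℕ, ENNReal.ofReal (κ ^ n / n.factorial) *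
        (Z ω * (∫⁻ t in Set.Ioc s b, ENNReal.ofReal (f t ω)) ^ n) ∂P := by
        refine lintegral_mono fun ω => ?_
        refine (mul_le_mul_right (hpt ω) (Z ω)).trans (le_of_eq ?_)
        rw [← ENNReal.tsum_mul_left]
        congr 1; funext n; ring
    _ = ∑' n : ℕ, ENNReal.ofReal (κ ^ n / n.factorial) *
        ∫⁻ ω, (Z ω * (∫⁻ t in Set.Ioc s b, ENNReal.ofReal (f t ω)) ^ n) ∂P := by
        rw [lintegral_tsum (fun n => by fun_prop)]
        congr 1; funext n
        rw [lintegral_const_mul _ (by fun_prop)]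
    _ ≤ ∑' n : ℕ, (2⁻¹ : ENNReal) ^ n * (ENNReal.ofReal (Real.exp (l * (b - s))) * ∫⁻ ω, Z ω ∂P) := by
        refine ENNReal.tsum_le_tsum fun n => ?_
        refine (mul_le_mul_right (mom n) _).trans (le_of_eq ?_)
        have : (2⁻¹ : ENNReal) ^ n = ENNReal.ofReal (κ ^ n / n.factorial) *
            (n.factorial * ENNReal.ofReal (a * Real.sqrt (Real.pi / l)) ^ n) := by
          rw [← ENNReal.ofReal_natCast, ← ENNReal.ofReal_pow (by positivity),
            ← ENNReal.ofReal_mul (by positivity), ← ENNReal.ofReal_mul (by positivity)]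
          have e : κ ^ n / (n.factorial : ℝ) * (n.factorial * (a * Real.sqrt (Real.pi / l)) ^ n)
             = (1/2) ^ n := by
            rw [← hq, mul_pow κ]
            have : (n.factorial : ℝ) ≠ 0 := by positivity
            field_simp
          rw [e, ENNReal.ofReal_pow (by norm_num)]
          congr 1
          rw [one_div, ENNReal.ofReal_inv_of_pos (by norm_num)]; norm_num
        rw [this]; ring
    _ = _ := by
        rw [ENNReal.tsum_mul_right, ENNReal.tsum_geometric, ENNReal.one_sub_inv_two, inv_inv,
          ENNReal.ofReal_mul (by norm_num), ← mul_assoc]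
        norm_num

/-- Khasminskii-type lemma: given `T`, `C₀` and `κ > 0`, there is a constant `C(T,κ)`,
not depending on the Brownian motion (in particular not on its initial law), such that for any
`(G_t)`-Brownian motion satisfying the conditional integral estimate with constant `C₀`, any
continuous path `x` and all `0 ≤ T₁ ≤ T₂ ≤ T` with `T₂ − T₁ < 1/(C₀² T κ²)`,
`E[exp(κ ∫_{T₁}^{T₂} F_t(w,x) dt) | G_{T₁}] ≤ C(T,κ)` almost surely. -/
theorem khasminskii_conditional_exponential (T C₀ κ : ℝ) (hT : 0 < T) (hC₀ : 0 < C₀)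
    (hκ : 0 < κ) :
    ∃ C : ℝ,
      ∀ (Ω : Type) (m : MeasurableSpace Ω) (P : Measure Ω),
        IsProbabilityMeasure P →
        ∀ (G : Filtration ℝ m) (W : ℝ → Ω → ℝ), IsBMFiltered P G W →
          (∀ x : ℝ → ℝ, Continuous x →
            ∀ t₁ t₂ : ℝ, 0 ≤ t₁ → t₁ ≤ t₂ → t₂ ≤ T →
              ∀ᵐ ω ∂P,
                (∫ t in Set.Ioc t₁ t₂,
                    (P[(fun ω' => F t (fun u => W u ω') x)|G t₁]) ω)
                  ≤ C₀ * Real.sqrt T * Real.sqrt (t₂ - t₁)) →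
          ∀ x : ℝ → ℝ, Continuous x →
            ∀ T₁ T₂ : ℝ, 0 ≤ T₁ → T₁ ≤ T₂ → T₂ ≤ T →
              T₂ - T₁ < 1 / (C₀ ^ 2 * T * κ ^ 2) →
              ∀ᵐ ω ∂P,
                (P[(fun ω' => Real.exp (κ * ∫ t in Set.Ioc T₁ T₂,
                    F t (fun u => W u ω') x))|G T₁]) ω ≤ C := by
  set l : ℝ := Real.pi * (32 * κ * Real.sqrt T) ^ 2 with hl
  have hsT : 0 < Real.sqrt T := Real.sqrt_pos.2 hT
  have hl0 : 0 < l := by have := Real.pi_pos; positivity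
  refine ⟨2 * Real.exp (l * T), ?_⟩
  intro Ω m P hP G W hW _ x hx T₁ T₂ h1 h12 h2 _
  have hq : κ * (16 * Real.sqrt T * Real.sqrt (Real.pi / l)) = 1 / 2 := by
    have : Real.pi / l = ((32 * κ * Real.sqrt T)⁻¹) ^ 2 := by
      rw [hl]; have := Real.pi_pos; field_simp
    rw [this, Real.sqrt_sq (by positivity)]
    field_simp; norm_num
  have hWj : Measurable (fun p : ℝ × Ω => W p.1 p.2) :=
    measurable_uncurry_of_continuous_of_measurable (u := W) 
      (fun ω => hW.1 ω) (fun t => (hW.2.1 t).mono (G.le t) le_rfl)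
  have hf : Measurable (Function.uncurry fun t ω => F t (fun u => W u ω) x) :=
    (aux_measH x hx).comp (measurable_fst.prodMk hWj)
  have hG : ∀ t, Measurable[G t] (fun ω => F t (fun u => W u ω) x) := fun t =>
    ((aux_measH x hx).comp (measurable_const.prodMk measurable_id : Measurable fun y : ℝ => (t, y))).comp
      (hW.2.1 t)
  have main := aux_expmom (P := P) hf (fun t ω => sq_nonneg _) hG (16 * Real.sqrt T) l T₂ κ
    (by positivity) hl0 hκ hq
    (fun s t hs hst ht Z hZ => aux_core hW x hx T s t hs hst (ht.trans h2) Z hZ) T₁ h1 h12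
  set X : Ω → ℝ := fun ω => Real.exp (κ * ∫ t in Set.Ioc T₁ T₂, F t (fun u => W u ω) x) with hX
  have hXm : Measurable X := by
    have : StronglyMeasurable fun ω => ∫ t in Set.Ioc T₁ T₂, F t (fun u => W u ω) x :=
      (hf.comp measurable_swap).stronglyMeasurable.integral_prod_right' 
    exact (this.measurable.const_mul κ).exp
  have hX0 : ∀ ω, 0 ≤ X ω := fun ω => (Real.exp_pos _).le
  have hXi : Integrable X P := by
    refine ⟨hXm.aestronglyMeasurable, ?_⟩
    rw [hasFiniteIntegral_iff_ofReal (Filter.Eventually.of_forall hX0)]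
    have := main (fun _ => 1) measurable_const
    simp only [one_mul, lintegral_const, measure_univ, mul_one] at this
    exact this.trans_lt ENNReal.ofReal_lt_top
  have hset : ∀ A, MeasurableSet[G T₁] A → ∫ ω in A, X ω ∂P ≤ 2 * Real.exp (l * T) * P.real A := by
    intro A hA
    have hA' := G.le T₁ A hA
    have := main (A.indicator fun _ => 1) (measurable_const.indicator hA)
    have e : ∀ ω, (A.indicator (fun _ => (1:ENNReal)) ω) * ENNReal.ofReal (X ω) =
        A.indicator (fun ω => ENNReal.ofReal (X ω)) ω := by
      intro ω; by_cases h : ω ∈ A <;> simp [h]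
    simp only [hX] at e
    simp only [e] at this
    rw [lintegral_indicator hA', lintegral_indicator hA', setLIntegral_one] at this
    rw [integral_eq_lintegral_of_nonneg_ae (Filter.Eventually.of_forall hX0) hXm.aestronglyMeasurable]
    have h3 := ENNReal.toReal_mono (by finiteness) this
    rw [ENNReal.toReal_mul, ENNReal.toReal_ofReal (by positivity)] at h3
    refine h3.trans ?_
    rw [Measure.real]
    gcongr
    linarith
  have hle : G T₁ ≤ m := G.le T₁
  have hfin : (P[X|G T₁]) ≤ᵐ[P.trim hle] fun _ => 2 * Real.exp (l * T) := by
    refine ae_le_of_forall_setIntegral_le (integrable_condExp.trim hle stronglyMeasurable_condExp)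
      (integrable_const _) fun A hA _ => ?_
    rw [← setIntegral_trim hle stronglyMeasurable_condExp hA, setIntegral_condExp hle hXi hA,
      setIntegral_const, smul_eq_mul, mul_comm, Measure.real, trim_measurableSet_eq hle hA]
    exact hset A hA
  exact ae_le_of_ae_le_trim hfin
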